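/- For all n ≥ 11, there is no permutation π ∈ S_n such that both π and θ(π) avoid the pattern 123; that is, t_n(123) = 0. -/

import Mathlib

/-- The one-line word of the image of `π` under the fundamental bijection:
write `π` in standard cycle form (every cycle written with its largest element
first, cycles listed in increasing order of their largest elements) and erase
the parentheses.  The cycle maxima are exactly the `x` with `π^[k] x ≤ x` for
all `k`, and the cycle of `x` is `x, π x, π² x, …` up to the period of `x`. -/
noncomputable def fundWord {n : ℕ} (π : Equiv.Perm (Fin n)) : List (Fin n) :=
  ((List.finRange n).filter fun x => (List.range n).all fun k => decide ((⇑π)^[k] x ≤ x)).flatMap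
    fun x => (List.range (Function.minimalPeriod (⇑π) x)).map fun k => (⇑π)^[k] x

/-- The permutation whose one-line notation is the word `w`
(junk value if `w` is not the one-line notation of a permutation). -/
noncomputable def permOfWord {n : ℕ} (w : List (Fin n)) : Equiv.Perm (Fin n) :=
  Function.invFun (fun σ : Equiv.Perm (Fin n) => (List.finRange n).map ⇑σ) w

/-- The fundamental bijection `θ`. -/
noncomputable def theta {n : ℕ} (π : Equiv.Perm (Fin n)) : Equiv.Perm (Fin n) :=
  permOfWord (fundWord π)

/-- `π` contains the pattern `σ`. -/
def Contains {k n : ℕ} (σ : Equiv.Perm (Fin k)) (π : Equiv.Perm (Fin n)) : Prop :=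
  ∃ f : Fin k → Fin n, StrictMono f ∧ ∀ a b : Fin k, π (f a) < π (f b) ↔ σ a < σ b

/-- `π` avoids the pattern `σ`. -/
def Avoids {k n : ℕ} (π : Equiv.Perm (Fin n)) (σ : Equiv.Perm (Fin k)) : Prop :=
  ¬ Contains σ π

noncomputable def p123 : Equiv.Perm (Fin 3) := Equiv.ofBijective ![0, 1, 2] (by decide)
noncomputable def p132 : Equiv.Perm (Fin 3) := Equiv.ofBijective ![0, 2, 1] (by decide)
noncomputable def p213 : Equiv.Perm (Fin 3) := Equiv.ofBijective ![1, 0, 2] (by decide)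
noncomputable def p231 : Equiv.Perm (Fin 3) := Equiv.ofBijective ![1, 2, 0] (by decide)
noncomputable def p312 : Equiv.Perm (Fin 3) := Equiv.ofBijective ![2, 0, 1] (by decide)
noncomputable def p321 : Equiv.Perm (Fin 3) := Equiv.ofBijective ![2, 1, 0] (by decide)

/-- The direct sum `π ⊕ τ` of two permutations. -/
def directSum {n m : ℕ} (π : Equiv.Perm (Fin n)) (τ : Equiv.Perm (Fin m)) :
    Equiv.Perm (Fin (n + m)) :=
  finSumFinEquiv.permCongr (Equiv.sumCongr π τ)

/-- A permutation is irreducible if it is not a direct sum of two nonempty permutations. -/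
def IrreduciblePerm {n : ℕ} (π : Equiv.Perm (Fin n)) : Prop :=
  ¬ ∃ (a b : ℕ) (_ : 0 < a) (_ : 0 < b) (h : a + b = n)
      (σ : Equiv.Perm (Fin a)) (τ : Equiv.Perm (Fin b)),
      π = (finCongr h).permCongr (directSum σ τ)

/-- A permutation is cyclic if its cycle decomposition is a single cycle of full length,
i.e. it acts transitively. -/
def IsCyclicPerm {n : ℕ} (π : Equiv.Perm (Fin n)) : Prop :=
  ∀ x y : Fin n, ∃ k : ℕ, (⇑π)^[k] x = y

section CycleWords

variable {α : Type*} [LinearOrder α] {f : α → α} {s t : ℕ → α} {c d : ℕ}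

/-- `s 0, …, s (d - 1)` is a cycle of `f` that starts with its largest element and avoids `123`
as a word. -/
structure IsCycleWord (f : α → α) (s : ℕ → α) (d : ℕ) : Prop where
  pos : 0 < d
  step : ∀ i, f (s i) = s (i + 1)
  closes : s d = s 0
  le_zero : ∀ i, s i ≤ s 0
  inj : ∀ i j, i < d → j < d → s i = s j → i = j
  avoids : ∀ i j k, i < j → j < k → k < d → s i < s j → s j < s k → False

/-- The function `f` has no increasing subsequence of length three. -/
def NoInc (f : α → α) : Prop :=
  ∀ x y z, x < y → y < z → f x < f y → f y < f z → False

theorem IsCycleWord.not_descents (hf : NoInc f) (hs : IsCycleWord f s d) (i : ℕ)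
    (h₀ : s (i + 1) < s i) (h₁ : s (i + 2) < s (i + 1)) (h₂ : s (i + 3) < s (i + 2)) : False := by
  refine hf _ _ _ h₁ h₀ ?_ ?_ <;> simpa only [hs.step]

theorem IsCycleWord.ne (hs : IsCycleWord f s d) {i j : ℕ} (hij : i < j) (hj : j < d) :
    s i ≠ s j := fun h => hij.ne (hs.inj i j (hij.trans hj) hj h)

theorem IsCycleWord.lt_or_lt (hs : IsCycleWord f s d) {i : ℕ} (hi : i + 1 < d) :
    s i < s (i + 1) ∨ s (i + 1) < s i := lt_or_gt_of_ne (hs.ne i.lt_succ_self hi)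

theorem IsCycleWord.exists_ascent (hf : NoInc f) (hs : IsCycleWord f s d) (i : ℕ)
    (hi : i + 3 < d) :
    s i < s (i + 1) ∨ s (i + 1) < s (i + 2) ∨ s (i + 2) < s (i + 3) := by
  by_contra! h
  have h₀ := hs.ne (i := i) (j := i + 1) (by omega) (by omega)
  have h₁ := hs.ne (i := i + 1) (j := i + 2) (by omega) (by omega)
  have h₂ := hs.ne (i := i + 2) (j := i + 3) (by omega) (by omega)
  exact hs.not_descents hf i (lt_of_le_of_ne h.1 h₀.symm) (lt_of_le_of_ne h.2.1 h₁.symm)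
    (lt_of_le_of_ne h.2.2 h₂.symm)

theorem IsCycleWord.bottom_lt (hs : IsCycleWord f s d) {i j : ℕ} (hij : i < j) (hj : j + 1 < d)
    (ha : s j < s (j + 1)) : s j < s i :=
  lt_of_le_of_ne (not_lt.1 fun h => hs.avoids i j (j + 1) hij (by omega) hj h ha)
    (hs.ne hij (by omega)).symm

theorem IsCycleWord.lt_top (hs : IsCycleWord f s d) {i j : ℕ} (hij : i + 1 < j) (hj : j < d)
    (ha : s i < s (i + 1)) : s j < s (i + 1) :=
  lt_of_le_of_ne (not_lt.1 fun h => hs.avoids i (i + 1) j (by omega) hij hj ha h)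
    (hs.ne hij hj).symm

theorem IsCycleWord.not_ascent_succ (hs : IsCycleWord f s d) {i : ℕ} (hi : i + 2 < d)
    (ha : s i < s (i + 1)) : ¬ s (i + 1) < s (i + 2) :=
  fun h => hs.avoids i (i + 1) (i + 2) (by omega) (by omega) hi ha h

theorem IsCycleWord.not_three_ascents (hf : NoInc f) (hs : IsCycleWord f s d) {i j k : ℕ}
    (hij : i < j) (hjk : j < k) (hk : k + 1 < d)
    (hi : s i < s (i + 1)) (hj : s j < s (j + 1)) (hk' : s k < s (k + 1)) : False := by
  refine hf _ _ _ (hs.bottom_lt hjk hk hk') (hs.bottom_lt hij (by omega) hj) ?_ ?_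
  · simpa only [hs.step] using hs.lt_top (by omega) hk hj
  · simpa only [hs.step] using hs.lt_top (by omega) (by omega) hi

theorem IsCycleWord.length_le (hf : NoInc f) (hs : IsCycleWord f s d) : d ≤ 9 := by
  by_contra! hd
  have no := fun i j k h₁ h₂ h₃ => hs.not_three_ascents hf (i := i) (j := j) (k := k) h₁ h₂ h₃
  rcases hs.exists_ascent hf 0 (by omega) with h | h | h <;>
  rcases hs.exists_ascent hf 3 (by omega) with h' | h' | h' <;>
  rcases hs.exists_ascent hf 6 (by omega) with h'' | h'' | h'' <;>
  exact no _ _ _ (by omega) (by omega) (by omega) h h' h''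

theorem IsCycleWord.not_length_nine (hf : NoInc f) (hs : IsCycleWord f s 9) {a b : α}
    (hab : f a = b) (hba : f b = a) (hlt : b < a)
    (hbs : ∀ i, i < 9 → s i ≠ b) (has : ∀ i, i < 9 → s i ≠ a)
    (hav : ∀ j k, j < k → k < 9 → b < s j → s j < s k → False) : False := by
  have no := fun i j k h₁ h₂ h₃ => hs.not_three_ascents hf (i := i) (j := j) (k := k) h₁ h₂ h₃
  have ne := fun i j h₁ h₂ => hs.ne (i := i) (j := j) h₁ h₂
  have h2 : s 2 < s 3 := by
    rcases hs.exists_ascent hf 0 (by omega) with h | h | h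
    · exact absurd (hs.le_zero 1) (not_le.2 h)
    · rcases hs.exists_ascent hf 2 (by omega) with h' | h' | h' <;>
      rcases hs.exists_ascent hf 5 (by omega) with h'' | h'' | h'' <;>
      first
      | exact h'
      | exact (no _ _ _ (by omega) (by omega) (by omega) h h' h'').elim
    · exact h
  have h5 : s 5 < s 6 := by
    rcases hs.exists_ascent hf 3 (by omega) with h | h | h
    · exact (hs.not_ascent_succ (by omega) h2 h).elim
    · rcases hs.exists_ascent hf 5 (by omega) with h' | h' | h' <;>
      exact (no _ _ _ (by omega) (by omega) (by omega) h2 h h').elim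
    · exact h
  have desc : ∀ i, i < 8 → i ≠ 2 → i ≠ 5 → s (i + 1) < s i := by
    intro i hi h₂ h₅
    refine (hs.lt_or_lt (by omega)).resolve_left fun h => ?_
    rcases lt_trichotomy i 2 with h' | h' | h'
    · exact no i 2 5 h' (by omega) (by omega) h h2 h5
    · exact h₂ h'
    rcases lt_trichotomy i 5 with h'' | h'' | h''
    · exact no 2 i 5 h' (by omega) (by omega) h2 h h5
    · exact h₅ h''
    · exact no 2 5 i (by omega) (by omega) (by omega) h2 h5 h
  have d0 := desc 0 (by omega) (by omega) (by omega)
  have d1 := desc 1 (by omega) (by omega) (by omega)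
  have d3 := desc 3 (by omega) (by omega) (by omega)
  have d4 := desc 4 (by omega) (by omega) (by omega)
  have d6 := desc 6 (by omega) (by omega) (by omega)
  have d7 := desc 7 (by omega) (by omega) (by omega)
  have e := hs.step
  have e8 : f (s 8) = s 0 := by rw [e, hs.closes]
  norm_num at d0 d1 d3 d4 d6 d7
  have l1b : s 2 < b := lt_of_le_of_ne
    (not_lt.1 fun h => hav 2 3 (by omega) (by omega) h h2) (hbs 2 (by omega))
  have l2l1 : s 5 < s 2 := hs.bottom_lt (by omega) (by omega) h5
  have r3r2 : s 6 < s 3 := hs.lt_top (i := 2) (by omega) (by omega) h2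
  have r2n : s 3 < s 0 := lt_of_le_of_ne (hs.le_zero 3) (ne 0 3 (by omega) (by omega)).symm
  have l3l1 : s 8 < s 2 := by
    refine lt_of_le_of_ne (not_lt.1 fun h => ?_) (ne 2 8 (by omega) (by omega)).symm
    refine hf _ _ _ l2l1 h ?_ ?_ <;> simpa only [e 2, e 5, e8]
  have ar2 : a < s 3 := by
    refine lt_of_le_of_ne (not_lt.1 fun h => ?_) (has 3 (by omega)).symm
    refine hf _ _ _ l2l1 l1b ?_ ?_ <;> simpa only [e, hba]
  have m1m2 : s 1 < s 4 := by
    refine lt_of_le_of_ne (not_lt.1 fun h => ?_) (ne 1 4 (by omega) (by omega))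
    refine hf _ _ _ h d0 ?_ ?_ <;> simpa only [e]
  have m1m3 : s 1 < s 7 := by
    refine lt_of_le_of_ne (not_lt.1 fun h => ?_) (ne 1 7 (by omega) (by omega))
    refine hf _ _ _ h d0 ?_ ?_ <;> simpa only [e]
  have r3m2 : s 6 < s 4 := lt_of_le_of_ne
    (not_lt.1 fun h => hs.avoids 2 4 6 (by omega) (by omega) (by omega) (d1.trans m1m2) h)
    (ne 4 6 (by omega) (by omega)).symm
  have m2b : s 4 < b := by
    refine lt_of_le_of_ne (not_lt.1 fun h => ?_) (hbs 4 (by omega))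
    have m1b : s 1 < b := lt_of_le_of_ne
      (not_lt.1 fun h => hav 1 3 (by omega) (by omega) h (m1m2.trans d3)) (hbs 1 (by omega))
    refine hf _ _ _ (m1b.trans hlt) ar2 ?_ ?_ <;> simpa only [e, hab]
  refine hf _ _ _ (m1m3.trans d6) (r3m2.trans (m2b.trans hlt)) ?_ ?_
  · simpa only [e] using d1.trans m1m3
  · simpa only [e, hab] using d6.trans (r3m2.trans m2b)

theorem IsCycleWord.length_lt_eight (hf : NoInc f) (hs : IsCycleWord f s d) {a b c : α}
    (hab : f a = b) (hbc : f b = c) (hca : f c = a) (hba : b < a) (hcb : c < b) (ha0 : a < s 0)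
    (hbs : ∀ i, i < d → s i ≠ b) (hcs : ∀ i, i < d → s i ≠ c) (has : ∀ i, i < d → s i ≠ a)
    (hav : ∀ j k, j < k → k < d → c < s j → s j < s k → False) : d < 8 := by
  by_contra! hd
  have no := fun i j k h₁ h₂ h₃ => hs.not_three_ascents hf (i := i) (j := j) (k := k) h₁ h₂ h₃
  have ne := fun i j h₁ h₂ => hs.ne (i := i) (j := j) h₁ h₂
  have e := hs.step
  have bot : ∀ i, i + 1 < d → s i < s (i + 1) → s i < c := fun i hi h => lt_of_le_of_ne
    (not_lt.1 fun h' => hav i (i + 1) (by omega) hi h' h) (hcs i (by omega))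
  have mid : ∀ i, i < d → s (i + 1) < c → b < s i := by
    intro i hi h
    refine lt_of_le_of_ne (not_lt.1 fun h' => ?_) (hbs i hi).symm
    refine hf _ _ _ h' hba ?_ ?_ <;> simpa only [e, hab, hbc]
  have h1 : s 1 < s 2 := by
    rcases hs.exists_ascent hf 0 (by omega) with h | h | h
    · exact absurd (hs.le_zero 1) (not_le.2 h)
    · exact h
    · have m1b := mid 1 (by omega) (bot 2 (by omega) h)
      refine (hf _ _ _ hba ha0 ?_ ?_).elim <;> simpa only [e, hab, hbc]
  have h4 : s 4 < s 5 := by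
    rcases hs.exists_ascent hf 2 (by omega) with h | h | h
    · exact (hs.not_ascent_succ (by omega) h1 h).elim
    · rcases hs.exists_ascent hf 4 (by omega) with h' | h' | h' <;>
      exact (no _ _ _ (by omega) (by omega) (by omega) h1 h h').elim
    · exact h
  have hd8 : d = 8 := by
    by_contra! hne
    rcases hs.exists_ascent hf 5 (by omega) with h' | h' | h' <;>
    exact (no _ _ _ (by omega) (by omega) (by omega) h1 h4 h').elim
  subst hd8
  have e7 : f (s 7) = s 0 := by rw [e, hs.closes]
  have l1c := bot 1 (by omega) h1
  have l2l1 : s 4 < s 1 := hs.bottom_lt (by omega) (by omega) h4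
  have r3r2 : s 5 < s 2 := hs.lt_top (i := 1) (by omega) (by omega) h1
  have m2b := mid 3 (by omega) (l2l1.trans l1c)
  have r2a : s 2 < a := by
    refine lt_of_le_of_ne (not_lt.1 fun h => ?_) (has 2 (by omega))
    refine hf _ _ _ hba h ?_ ?_ <;> simpa only [e, hab, hbc]
  refine hf _ _ _ l2l1 l1c ?_ ?_ <;> simpa only [e, hca]

theorem IsCycleWord.length_add_length_le (hf : NoInc f) (ht : IsCycleWord f t c)
    (hs : IsCycleWord f s d) (hlt : t 0 < s 0) (hne : ∀ i j, i < c → j < d → s j ≠ t i)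
    (htts : ∀ i j k, i < j → j < c → k < d → t i < t j → t j < s k → False)
    (htss : ∀ i j k, i < c → j < k → k < d → t i < s j → s j < s k → False) : c + d ≤ 10 := by
  have hd := hs.length_le hf
  have desc : ∀ i, i + 1 < c → t (i + 1) < t i := fun i hi =>
    (ht.lt_or_lt hi).resolve_left fun h =>
      htts i (i + 1) 0 (by omega) hi hs.pos h ((ht.le_zero _).trans_lt hlt)
  by_contra! hcd
  have hc : c ≤ 3 := by
    by_contra! h
    exact ht.not_descents hf 0 (desc 0 (by omega)) (desc 1 (by omega)) (desc 2 (by omega))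
  obtain rfl | rfl : c = 2 ∨ c = 3 := by omega
  · obtain rfl : d = 9 := by omega
    refine hs.not_length_nine hf (ht.step 0) (by rw [ht.step, ht.closes]) (desc 0 (by omega))
      (fun i hi => hne 1 i (by omega) hi)
      (fun i hi => hne 0 i (by omega) hi) (fun j k hjk hk => htss 1 j k (by omega) hjk hk)
  · have := hs.length_lt_eight hf (ht.step 0) (ht.step 1) (by rw [ht.step, ht.closes])
      (desc 0 (by omega)) (desc 1 (by omega)) hlt (fun i hi => hne 1 i (by omega) hi)
      (fun i hi => hne 2 i (by omega) hi)
      (fun i hi => hne 0 i (by omega) hi) (fun j k hjk hk => htss 2 j k (by omega) hjk hk)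
    omega

end CycleWords

section FundWord

open List Function

variable {n : ℕ} {π : Equiv.Perm (Fin n)}

theorem minimalPeriod_pos_perm (x : Fin n) : 0 < minimalPeriod π x :=
  minimalPeriod_pos_of_mem_periodicPts (π.injective.mem_periodicPts x)

theorem exists_iterate_eq_symm {x y : Fin n} {k : ℕ} (h : (⇑π)^[k] x = y) :
    ∃ j, (⇑π)^[j] y = x := by
  refine ⟨k * minimalPeriod π x - k, ?_⟩
  rw [← h, ← iterate_add_apply,
    Nat.sub_add_cancel (Nat.le_mul_of_pos_right k (minimalPeriod_pos_perm x))]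
  exact (isPeriodicPt_minimalPeriod π x).const_mul k

/-- The cycle of `π` through `x`, written as a word starting with `x`. -/
noncomputable def cycleWord (π : Equiv.Perm (Fin n)) (x : Fin n) : List (Fin n) :=
  (range (minimalPeriod π x)).map fun k => (⇑π)^[k] x

/-- The largest elements of the cycles of `π`, in increasing order. -/
noncomputable def cycleMaxima (π : Equiv.Perm (Fin n)) : List (Fin n) :=
  (finRange n).filter fun x => (range n).all fun k => decide ((⇑π)^[k] x ≤ x)

theorem fundWord_eq_flatMap : fundWord π = (cycleMaxima π).flatMap (cycleWord π) := rfl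

theorem mem_cycleWord {x y : Fin n} : y ∈ cycleWord π x ↔ ∃ k, (⇑π)^[k] x = y := by
  simp only [cycleWord, mem_map, mem_range]
  refine ⟨fun ⟨k, _, h⟩ => ⟨k, h⟩, fun ⟨k, h⟩ => ⟨k % minimalPeriod π x,
    Nat.mod_lt _ (minimalPeriod_pos_perm x), ?_⟩⟩
  rw [iterate_mod_minimalPeriod_eq, h]

theorem mem_cycleMaxima {x : Fin n} : x ∈ cycleMaxima π ↔ ∀ k, (⇑π)^[k] x ≤ x := by
  simp only [cycleMaxima, mem_filter, mem_finRange, true_and, all_eq_true, mem_range,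
    decide_eq_true_eq]
  refine ⟨fun h k => ?_, fun h k _ => h k⟩
  rw [← iterate_mod_minimalPeriod_eq]
  refine h _ ((Nat.mod_lt _ (minimalPeriod_pos_perm x)).trans_le ?_)
  simpa using minimalPeriod_le_card (f := π) (x := x)

theorem pairwise_lt_cycleMaxima : (cycleMaxima π).Pairwise (· < ·) :=
  (pairwise_lt_finRange n).filter _

theorem nodup_cycleWord (x : Fin n) : (cycleWord π x).Nodup :=
  Nodup.map_on (fun _ hi _ hj h => iterate_injOn_Iio_minimalPeriod (mem_range.1 hi)
    (mem_range.1 hj) h) nodup_range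

theorem disjoint_cycleWord {x y : Fin n} (hx : x ∈ cycleMaxima π) (hy : y ∈ cycleMaxima π)
    (hxy : x ≠ y) : (cycleWord π x).Disjoint (cycleWord π y) := by
  have key : ∀ {x y z : Fin n}, x ∈ cycleMaxima π → z ∈ cycleWord π x → z ∈ cycleWord π y →
      y ≤ x := by
    intro x y z hx hzx hzy
    obtain ⟨k, hk⟩ := mem_cycleWord.1 hzx
    obtain ⟨i, hi⟩ := mem_cycleWord.1 hzy
    obtain ⟨j, hj⟩ := exists_iterate_eq_symm hi
    rw [← hj, ← hk, ← iterate_add_apply]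
    exact mem_cycleMaxima.1 hx _
  exact fun z hzx hzy => hxy (le_antisymm (key hy hzy hzx) (key hx hzx hzy))

theorem nodup_fundWord : (fundWord π).Nodup := by
  rw [fundWord_eq_flatMap, nodup_flatMap]
  refine ⟨fun x _ => nodup_cycleWord x, ?_⟩
  exact pairwise_lt_cycleMaxima.imp_of_mem fun hx hy h => disjoint_cycleWord hx hy h.ne

theorem mem_fundWord (y : Fin n) : y ∈ fundWord π := by
  obtain ⟨x, ⟨k, hk⟩, hx⟩ := Set.exists_max_image (Set.range fun k => (⇑π)^[k] y) id
    (Set.toFinite _) ⟨y, 0, rfl⟩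
  rw [fundWord_eq_flatMap, mem_flatMap]
  refine ⟨x, mem_cycleMaxima.2 fun j => hx _ ⟨j + k, ?_⟩, mem_cycleWord.2
    (exists_iterate_eq_symm hk)⟩
  rw [← hk]
  exact iterate_add_apply _ _ _ _

theorem length_fundWord : (fundWord π).length = n := by
  have h : (fundWord π).toFinset = Finset.univ := by ext; simp [mem_fundWord]
  rw [← toFinset_card_of_nodup nodup_fundWord, h, Finset.card_univ, Fintype.card_fin]

theorem map_theta_finRange : (finRange n).map (theta π) = fundWord π := by
  refine Function.invFun_eq (f := fun σ : Equiv.Perm (Fin n) => (finRange n).map ⇑σ) ?_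
  let g : Fin n → Fin n := fun i => (fundWord π).get (i.cast length_fundWord.symm)
  have hg : Injective g := fun i j h => by
    simpa using nodup_fundWord.injective_get h
  refine ⟨Equiv.ofBijective g (Finite.injective_iff_bijective.1 hg), ?_⟩
  refine ext_getElem (by simp [length_fundWord]) fun i h₁ h₂ => ?_
  simp [g]

/-- The word `w` has no increasing subsequence of length three. -/
def WordNoInc (w : List (Fin n)) : Prop :=
  ∀ x y z, [x, y, z] <+ w → x < y → y < z → False

theorem noInc_of_avoids (h : Avoids π p123) : NoInc π := by
  intro x y z hxy hyz hxy' hyz'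
  refine h ⟨![x, y, z], ?_, ?_⟩
  · intro i j hij
    fin_cases i <;> fin_cases j <;> simp_all [hxy.trans hyz]
  · have h₁ := hxy'.trans hyz'
    intro i j
    fin_cases i <;> fin_cases j <;>
      simp [p123, hxy', hyz', h₁, hxy'.le, hyz'.le, h₁.le]

theorem wordNoInc_of_avoids (h : Avoids (theta π) p123) : WordNoInc (fundWord π) := by
  intro x y z hs hxy hyz
  rw [← map_theta_finRange, sublist_map_iff] at hs
  obtain ⟨l, hl, he⟩ := hs
  obtain ⟨i, j, k, rfl⟩ := length_eq_three.1 (by simpa using (congrArg length he).symm)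
  simp only [map_cons, map_nil, cons.injEq, and_true] at he
  obtain ⟨rfl, rfl, rfl⟩ := he
  have hp := (pairwise_lt_finRange n).sublist hl
  simp only [pairwise_cons, mem_cons, not_mem_nil, or_false, forall_eq_or_imp, forall_eq] at hp
  exact noInc_of_avoids h _ _ _ hp.1.1 hp.2.1 hxy hyz

theorem map_sublist_cycleWord {x : Fin n} {l : List ℕ} (hl : l.Pairwise (· < ·))
    (hlt : ∀ i ∈ l, i < minimalPeriod π x) : l.map (fun k => (⇑π)^[k] x) <+ cycleWord π x := by
  refine Sublist.map _ (sublist_of_subperm_of_pairwise (r := (· < ·)) ?_ hl pairwise_lt_range)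
  exact Nodup.subperm (hl.imp Nat.ne_of_lt) fun i hi => mem_range.2 (hlt i hi)

theorem isCycleWord_of_wordNoInc {x : Fin n} (hx : x ∈ cycleMaxima π)
    (h : WordNoInc (cycleWord π x)) :
    IsCycleWord π (fun k => (⇑π)^[k] x) (minimalPeriod π x) where
  pos := minimalPeriod_pos_perm x
  step i := (iterate_succ_apply' _ _ _).symm
  closes := isPeriodicPt_minimalPeriod π x
  le_zero := mem_cycleMaxima.1 hx
  inj _ _ hi hj hij := iterate_injOn_Iio_minimalPeriod hi hj hij
  avoids i j k hij hjk hk := h _ _ _ <| map_sublist_cycleWord (l := [i, j, k])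
    (by simp; omega) (by simp; omega)

theorem le_ten_of_avoids (hf : NoInc π) (hw : WordNoInc (fundWord π)) : n ≤ 10 := by
  have hlen := length_fundWord (π := π)
  have hcard : ∀ x, (cycleWord π x).length = minimalPeriod π x := by simp [cycleWord]
  have hself : ∀ x, [x] <+ cycleWord π x := fun x =>
    singleton_sublist.2 (mem_cycleWord.2 ⟨0, rfl⟩)
  have hlt := pairwise_lt_cycleMaxima (π := π)
  rw [fundWord_eq_flatMap] at hlen hw
  rcases hM : cycleMaxima π with _ | ⟨x, _ | ⟨y, _ | ⟨z, l⟩⟩⟩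
  · simp_all
    omega
  · rw [hM] at hlen hw
    simp only [flatMap_cons, flatMap_nil, append_nil, hcard] at hlen hw
    have := (isCycleWord_of_wordNoInc (by simp [hM]) hw).length_le hf
    omega
  · rw [hM] at hlen hw hlt
    simp only [flatMap_cons, flatMap_nil, append_nil, length_append, hcard] at hlen hw
    have hx : x ∈ cycleMaxima π := by simp [hM]
    have hy : y ∈ cycleMaxima π := by simp [hM]
    have hxy : x < y := by simpa using hlt
    have hcx := isCycleWord_of_wordNoInc hx fun a b c h =>
      hw a b c (h.trans (sublist_append_left _ _))
    have hcy := isCycleWord_of_wordNoInc hy fun a b c h =>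
      hw a b c (h.trans (sublist_append_right _ _))
    have := hcx.length_add_length_le hf hcy hxy
      (fun i j _ _ h => disjoint_cycleWord hx hy hxy.ne (mem_cycleWord.2 ⟨i, rfl⟩)
        (mem_cycleWord.2 ⟨j, h⟩))
      (fun i j k hij hj hk => hw _ _ _ <| Sublist.append
        (map_sublist_cycleWord (l := [i, j]) (by simpa) (by simp; omega))
        (map_sublist_cycleWord (l := [k]) (by simp) (by simpa)))
      (fun i j k hi hjk hk => hw _ _ _ <| Sublist.append
        (map_sublist_cycleWord (l := [i]) (by simp) (by simpa))
        (map_sublist_cycleWord (l := [j, k]) (by simpa) (by simp; omega)))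
    omega
  · rw [hM] at hw hlt
    simp only [pairwise_cons, mem_cons, forall_eq_or_imp] at hlt
    refine (hw x y z ?_ hlt.1.1 hlt.2.1.1).elim
    simp only [flatMap_cons]
    exact (hself x).append ((hself y).append ((hself z).append (nil_sublist _)))

end FundWord

/-- for `n ≥ 11`, `t_n(123) = 0`. -/
theorem t_n_123_eq_zero (n : ℕ) (hn : 11 ≤ n) :
    Nat.card {π : Equiv.Perm (Fin n) // Avoids π p123 ∧ Avoids (theta π) p123} = 0 := by
  rw [Nat.card_eq_zero]
  refine Or.inl ⟨fun ⟨π, hπ, hθ⟩ => ?_⟩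
  have := le_ten_of_avoids (noInc_of_avoids hπ) (wordNoInc_of_avoids hθ)
  omega
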